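/- Let n ≥ 1, let κ > 0, and let A and B be real symmetric n×n matrices. For t ∈ ℝ let μ_1(t),…,μ_n(t) denote the eigenvalues (with multiplicity) of the real symmetric matrix A + t·B. Then the function f : ℝ → ℝ, f(t) := (1/√κ)·Σ_{i=1}^n arctan(μ_i(t)/√κ), is differentiable at t = 0 with f'(0) = tr( (κ·I + A²)⁻¹ · B ). -/

import Mathlib

open Matrix Real

lemma aux_spec {n : ℕ} {A : Matrix (Fin n) (Fin n) ℝ} (hA : A.IsHermitian) :
    ∃ U : Matrix (Fin n) (Fin n) ℝ, Uᵀ * U = 1 ∧ U * Uᵀ = 1 ∧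
      A = U * diagonal hA.eigenvalues * Uᵀ := by
  refine ⟨(hA.eigenvectorUnitary : Matrix (Fin n) (Fin n) ℝ), ?_, ?_, ?_⟩
  · have := Unitary.coe_star_mul_self hA.eigenvectorUnitary
    simpa [star_eq_conjTranspose] using this
  · have := Unitary.coe_mul_star_self hA.eigenvectorUnitary
    simpa [star_eq_conjTranspose] using this
  · have := hA.spectral_theorem
    rw [Unitary.conjStarAlgAut_apply] at this
    simpa [star_eq_conjTranspose, Function.comp_def] using this

lemma aux_trace {n : ℕ} (U V : Matrix (Fin n) (Fin n) ℝ) (a b : Fin n → ℝ) :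
    ((U * diagonal a * Uᵀ) * (V * diagonal b * Vᵀ)).trace
      = ∑ i, ∑ j, ((Uᵀ * V) i j) ^ 2 * (a i * b j) := by
  have h : ((U * diagonal a * Uᵀ) * (V * diagonal b * Vᵀ)).trace
      = ((diagonal a * (Uᵀ * V)) * (diagonal b * (Uᵀ * V)ᵀ)).trace := by
    rw [transpose_mul, transpose_transpose]
    have : (U * diagonal a * Uᵀ) * (V * diagonal b * Vᵀ)
      = U * (diagonal a * Uᵀ * (V * diagonal b * Vᵀ)) := by simp only [Matrix.mul_assoc]
    rw [this, trace_mul_comm]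
    simp only [Matrix.mul_assoc]
  rw [h]
  simp only [trace, diag, Matrix.mul_apply (M := diagonal a * (Uᵀ * V))]
  refine Finset.sum_congr rfl fun i _ => Finset.sum_congr rfl fun j _ => ?_
  rw [diagonal_mul, diagonal_mul, transpose_apply]
  ring

lemma aux_lip (κ : ℝ) (hκ : 0 < κ) (x y : ℝ) :
    |1 / (κ + x ^ 2) - 1 / (κ + y ^ 2)| ≤ (1 / (κ * √κ)) * |x - y| := by
  have hs : 0 < √κ := Real.sqrt_pos.2 hκ
  have hss : √κ ^ 2 = κ := Real.sq_sqrt hκ.le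
  set s := √κ
  have hx : 0 < κ + x ^ 2 := by positivity
  have hy : 0 < κ + y ^ 2 := by positivity
  have e : 1 / (κ + x ^ 2) - 1 / (κ + y ^ 2)
      = ((x + y) / ((κ + x ^ 2) * (κ + y ^ 2))) * (-(x - y)) := by
    field_simp
    ring
  rw [e, abs_mul, abs_neg]
  refine mul_le_mul_of_nonneg_right ?_ (abs_nonneg _)
  rw [abs_div, abs_of_pos (mul_pos hx hy), div_le_div_iff₀ (mul_pos hx hy) (by positivity)]
  have h1 : |x + y| ≤ |x| + |y| := abs_add_le x y
  have h2 : 2 * s * |x| ≤ κ + x ^ 2 := by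
    nlinarith [sq_nonneg (s - |x|), sq_abs x]
  have h3 : 2 * s * |y| ≤ κ + y ^ 2 := by
    nlinarith [sq_nonneg (s - |y|), sq_abs y]
  have h4 : κ * (2 * s * |x|) ≤ (κ + x ^ 2) * (κ + y ^ 2) := by
    rw [mul_comm κ]
    exact mul_le_mul h2 (by nlinarith [sq_nonneg y]) hκ.le hx.le
  have h5 : κ * (2 * s * |y|) ≤ (κ + x ^ 2) * (κ + y ^ 2) :=
    mul_le_mul (by nlinarith [sq_nonneg x]) h3 (by positivity) hx.le
  have h6 : |x + y| * (κ * s) ≤ (|x| + |y|) * (κ * s) :=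
    mul_le_mul_of_nonneg_right h1 (by positivity)
  nlinarith

lemma aux_taylor (κ : ℝ) (hκ : 0 < κ) (x y : ℝ) :
    |(1 / √κ) * arctan (y / √κ) - (1 / √κ) * arctan (x / √κ) - (1 / (κ + x ^ 2)) * (y - x)|
      ≤ (1 / (κ * √κ)) * (y - x) ^ 2 := by
  have hs : 0 < √κ := Real.sqrt_pos.2 hκ
  have hss : √κ ^ 2 = κ := Real.sq_sqrt hκ.le
  have hd : ∀ z : ℝ, HasDerivAt
      (fun z => (1 / √κ) * arctan (z / √κ) - (1 / (κ + x ^ 2)) * z)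
      (1 / (κ + z ^ 2) - 1 / (κ + x ^ 2)) z := by
    intro z
    have := ((((hasDerivAt_id z).div_const (√κ)).arctan).const_mul (1 / √κ)).sub
      ((hasDerivAt_id z).const_mul (1 / (κ + x ^ 2)))
    refine this.congr_deriv ?_
    have hz : 0 < κ + z ^ 2 := by positivity
    simp only [id, mul_one]
    congr 1
    rw [div_pow, hss]
    field_simp
    rw [hss]
  have hb := (convex_uIcc x y).norm_image_sub_le_of_norm_hasDerivWithin_le
    (C := (1 / (κ * √κ)) * |y - x|)
    (fun z _ => (hd z).hasDerivWithinAt) (fun z hz => ?_) Set.left_mem_uIcc Set.right_mem_uIcc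
  · simp only [Real.norm_eq_abs] at hb
    rw [mul_assoc, ← sq, sq_abs] at hb
    refine le_trans (le_of_eq ?_) hb
    congr 1
    ring
  · rw [Real.norm_eq_abs]
    refine (aux_lip κ hκ z x).trans ?_
    refine mul_le_mul_of_nonneg_left ?_ (by positivity)
    exact Set.abs_sub_left_of_mem_uIcc hz

lemma aux_main {n : ℕ} (κ : ℝ) (hκ : 0 < κ) {A M : Matrix (Fin n) (Fin n) ℝ}
    (hA : A.IsHermitian) (hM : M.IsHermitian) :
    |(1 / √κ) * ∑ i, arctan (hM.eigenvalues i / √κ)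
      - (1 / √κ) * ∑ i, arctan (hA.eigenvalues i / √κ)
      - ((κ • (1 : Matrix (Fin n) (Fin n) ℝ) + A ^ 2)⁻¹ * (M - A)).trace|
      ≤ (1 / (κ * √κ)) * ((M - A) * (M - A)).trace := by
  obtain ⟨U, hU1, hU2, hUA⟩ := aux_spec hA
  obtain ⟨V, hV1, hV2, hVM⟩ := aux_spec hM
  set l := hA.eigenvalues
  set m := hM.eigenvalues
  set W := Uᵀ * V with hW
  -- function calculus facts
  have mulU : ∀ a b : Fin n → ℝ, (U * diagonal a * Uᵀ) * (U * diagonal b * Uᵀ)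
      = U * diagonal (fun i => a i * b i) * Uᵀ := by
    intro a b
    rw [← diagonal_mul_diagonal]
    calc _ = U * diagonal a * (Uᵀ * U) * diagonal b * Uᵀ := by simp only [Matrix.mul_assoc]
      _ = _ := by rw [hU1]; simp only [Matrix.mul_assoc, Matrix.one_mul]
  have mulV : ∀ a b : Fin n → ℝ, (V * diagonal a * Vᵀ) * (V * diagonal b * Vᵀ)
      = V * diagonal (fun i => a i * b i) * Vᵀ := by
    intro a b
    rw [← diagonal_mul_diagonal]
    calc _ = V * diagonal a * (Vᵀ * V) * diagonal b * Vᵀ := by simp only [Matrix.mul_assoc]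
      _ = _ := by rw [hV1]; simp only [Matrix.mul_assoc, Matrix.one_mul]
  have oneU : U * diagonal (fun _ => (1:ℝ)) * Uᵀ = 1 := by
    rw [diagonal_one, Matrix.mul_one, hU2]
  have oneV : V * diagonal (fun _ => (1:ℝ)) * Vᵀ = 1 := by
    rw [diagonal_one, Matrix.mul_one, hV2]
  have trU : ∀ a : Fin n → ℝ, (U * diagonal a * Uᵀ).trace = ∑ i, a i := by
    intro a
    rw [trace_mul_comm, ← Matrix.mul_assoc, hU1, Matrix.one_mul, trace_diagonal]
  have trV : ∀ a : Fin n → ℝ, (V * diagonal a * Vᵀ).trace = ∑ i, a i := by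
    intro a
    rw [trace_mul_comm, ← Matrix.mul_assoc, hV1, Matrix.one_mul, trace_diagonal]
  have sumA : ∀ a : Fin n → ℝ, ∑ i, ∑ j, W i j ^ 2 * a i = ∑ i, a i := by
    intro a
    have := aux_trace U V a (fun _ => 1)
    rw [oneV, Matrix.mul_one, trU] at this
    rw [this]; simp [hW]
  have sumM : ∀ b : Fin n → ℝ, ∑ i, ∑ j, W i j ^ 2 * b j = ∑ i, b i := by
    intro b
    have := aux_trace U V (fun _ => 1) b
    rw [oneU, Matrix.one_mul, trV] at this
    rw [this]; simp [hW]
  have hpos : ∀ i, 0 < κ + l i ^ 2 := fun i => by positivity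
  have hinv : (κ • (1 : Matrix (Fin n) (Fin n) ℝ) + A ^ 2)⁻¹
      = U * diagonal (fun i => 1 / (κ + l i ^ 2)) * Uᵀ := by
    apply Matrix.inv_eq_left_inv
    have : κ • (1 : Matrix (Fin n) (Fin n) ℝ) + A ^ 2
        = U * diagonal (fun i => κ + l i ^ 2) * Uᵀ := by
      have e : diagonal (fun i => κ + l i ^ 2)
          = κ • diagonal (fun _ : Fin n => (1:ℝ)) + diagonal (fun i => l i * l i) := by
        rw [← diagonal_smul, diagonal_add]
        congr 1; ext i; simp [sq]
      rw [e, Matrix.mul_add, Matrix.add_mul, ← mulU, ← hUA, Matrix.mul_smul, Matrix.smul_mul,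
        oneU, sq]
    rw [this, mulU, ← oneU]
    congr 3
    ext i
    exact one_div_mul_cancel (hpos i).ne'
  have t1 : ((κ • (1 : Matrix (Fin n) (Fin n) ℝ) + A ^ 2)⁻¹ * (M - A)).trace
      = ∑ i, ∑ j, W i j ^ 2 * ((1 / (κ + l i ^ 2)) * (m j - l i)) := by
    rw [hinv, Matrix.mul_sub, trace_sub]
    have e1 := aux_trace U V (fun i => 1 / (κ + l i ^ 2)) m
    rw [← hVM] at e1
    have e2 := mulU (fun i => 1 / (κ + l i ^ 2)) l
    rw [← hUA] at e2
    rw [e1, e2, trU, ← sumA (fun i => 1 / (κ + l i ^ 2) * l i)]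
    simp only [← Finset.sum_sub_distrib, ← hW]
    refine Finset.sum_congr rfl fun i _ => Finset.sum_congr rfl fun j _ => ?_
    ring
  have t2 : ((M - A) * (M - A)).trace = ∑ i, ∑ j, W i j ^ 2 * (m j - l i) ^ 2 := by
    have e0 : ((M - A) * (M - A)).trace
        = (M * M).trace - 2 * (A * M).trace + (A * A).trace := by
      rw [Matrix.mul_sub, Matrix.sub_mul, Matrix.sub_mul, trace_sub, trace_sub, trace_sub,
        trace_mul_comm M A]
      ring
    have e1 := aux_trace U V l m
    rw [← hVM, ← hUA] at e1
    have e2 := mulU l l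
    rw [← hUA] at e2
    have e3 := mulV m m
    rw [← hVM] at e3
    rw [e0, e1, e2, e3, trU, trV, ← sumA (fun i => l i * l i),
      ← sumM (fun i => m i * m i)]
    simp only [Finset.mul_sum, ← Finset.sum_sub_distrib, ← Finset.sum_add_distrib, ← hW]
    refine Finset.sum_congr rfl fun i _ => Finset.sum_congr rfl fun j _ => ?_
    ring
  have t3 : (1 / √κ) * ∑ i, arctan (m i / √κ)
      = ∑ i, ∑ j, W i j ^ 2 * ((1 / √κ) * arctan (m j / √κ)) := by
    rw [sumM (fun j => (1 / √κ) * arctan (m j / √κ)), Finset.mul_sum]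
  have t4 : (1 / √κ) * ∑ i, arctan (l i / √κ)
      = ∑ i, ∑ j, W i j ^ 2 * ((1 / √κ) * arctan (l i / √κ)) := by
    rw [sumA (fun j => (1 / √κ) * arctan (l j / √κ)), Finset.mul_sum]
  rw [t1, t2, t3, t4]
  simp only [Finset.mul_sum, ← Finset.sum_sub_distrib]
  refine (Finset.abs_sum_le_sum_abs _ _).trans (Finset.sum_le_sum fun i _ => ?_)
  refine (Finset.abs_sum_le_sum_abs _ _).trans (Finset.sum_le_sum fun j _ => ?_)
  rw [← mul_sub, ← mul_sub, abs_mul, abs_of_nonneg (sq_nonneg (W i j)), mul_left_comm]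
  exact mul_le_mul_of_nonneg_left (aux_taylor κ hκ _ _) (sq_nonneg _)

theorem stmt_17 (n : ℕ) (hn : 1 ≤ n) (κ : ℝ) (hκ : 0 < κ)
    (A B : Matrix (Fin n) (Fin n) ℝ)
    (hA : A.IsHermitian) (hB : B.IsHermitian)
    (hAB : ∀ t : ℝ, (A + t • B).IsHermitian) :
    HasDerivAt
      (fun t : ℝ =>
        (1 / Real.sqrt κ) * ∑ i, Real.arctan ((hAB t).eigenvalues i / Real.sqrt κ))
      (((κ • (1 : Matrix (Fin n) (Fin n) ℝ) + A ^ 2)⁻¹ * B).trace) 0 := by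
  rw [hasDerivAt_iff_isLittleO_nhds_zero]
  have hO : (fun h : ℝ => h ^ 2) =o[nhds 0] fun h : ℝ => h := by
    simpa using Asymptotics.isLittleO_pow_pow (𝕜 := ℝ) (m := 1) (n := 2) (by norm_num)
  refine Asymptotics.IsBigO.trans_isLittleO ?_ hO
  refine Asymptotics.IsBigO.of_bound ((1 / (κ * √κ)) * (B * B).trace)
    (Filter.Eventually.of_forall fun t => ?_)
  have h := aux_main κ hκ (hAB 0) (hAB (0 + t))
  have e0 : A + (0:ℝ) • B = A := by simp
  have e : A + (0 + t) • B - (A + (0:ℝ) • B) = t • B := by simp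
  rw [e] at h
  have e1 : (κ • (1 : Matrix (Fin n) (Fin n) ℝ) + (A + (0:ℝ) • B) ^ 2)
    = κ • (1 : Matrix (Fin n) (Fin n) ℝ) + A ^ 2 := by rw [e0]
  rw [e1, Matrix.mul_smul, Matrix.smul_mul, Matrix.mul_smul, trace_smul, trace_smul,
    trace_smul] at h
  rw [Real.norm_eq_abs, Real.norm_eq_abs, abs_of_nonneg (sq_nonneg t)]
  refine h.trans (le_of_eq ?_)
  simp only [smul_eq_mul]
  ring
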